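/- Let k₁, k₂ > 0, λ₁, λ₂ ≥ 0 and γ̄₁, γ̄₂ > 0. Let W₁ and W₂ be independent random variables where Wᵢ has density (1/γ̄ᵢ)·f(kᵢ, λᵢ; x/γ̄ᵢ) on (0, ∞) (a noncentral chi-square law with 2kᵢ degrees of freedom, noncentrality 2λᵢ and scale γ̄ᵢ/2·2 = γ̄ᵢ). Then the distribution of the product W₁·W₂ has density on (0, ∞) given by x ↦ ∑_{j₁=0}^∞ ∑_{j₂=0}^∞ (e^{−λ₁} λ₁^{j₁}/j₁!) (e^{−λ₂} λ₂^{j₂}/j₂!) · (γ̄₁γ̄₂)^{−1} · g_{k₁+j₁, k₂+j₂}( x/(γ̄₁γ̄₂) ), where g_{a,α}(y) := y^{α−1}/(Γ(a)Γ(α)) · ∫₀^∞ t^{a−α−1} e^{−t − y/t} dt is the density of the product of two independent Gamma(shape, rate 1) random variables with shapes a and α. In words: the product of two independent noncentral chi-square random variables is a double Poisson mixture of generalized-K-squared laws. -/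

import Mathlib

open MeasureTheory ProbabilityTheory

/-- Noncentral chi-square density with `2k` degrees of freedom, noncentrality `2λ`
and scale `1/2`. -/
noncomputable def ncx2 (k lam x : ℝ) : ℝ :=
  ∑' j : ℕ, (Real.exp (-lam) * lam ^ j / (j.factorial : ℝ)) *
    x ^ (k + (j : ℝ) - 1) * Real.exp (-x) / Real.Gamma (k + (j : ℝ))

/-- Scaled noncentral chi-square density (scale `γ̄`), vanishing off `(0, ∞)`. -/
noncomputable def ncx2Scaled (k lam γ x : ℝ) : ℝ :=
  if 0 < x then (1 / γ) * ncx2 k lam (x / γ) else 0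

/-- Density of the product of two independent Gamma(shape, rate 1) random variables with
shapes `a` and `α`: `g_{a,α}(y) = y^{α−1}/(Γ(a)Γ(α)) ∫₀^∞ t^{a−α−1} e^{−t−y/t} dt`. -/
noncomputable def gammaProdDensity (a α y : ℝ) : ℝ :=
  y ^ (α - 1) / (Real.Gamma a * Real.Gamma α) *
    ∫ t in Set.Ioi (0 : ℝ), t ^ (a - α - 1) * Real.exp (-t - y / t)

noncomputable def tmA (k lam γ : ℝ) (j : ℕ) (x : ℝ) : ℝ :=
  (1 / γ) * ((Real.exp (-lam) * lam ^ j / (j.factorial : ℝ)) *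
    (x / γ) ^ (k + (j : ℝ) - 1) * Real.exp (-(x / γ)) / Real.Gamma (k + (j : ℝ)))

noncomputable def qqA (k lam γ x : ℝ) : ENNReal := ∑' j : ℕ, ENNReal.ofReal (tmA k lam γ j x)

lemma tmA_meas (k lam γ : ℝ) (j : ℕ) : Measurable (tmA k lam γ j) := by
  unfold tmA; fun_prop

lemma qqA_meas (k lam γ : ℝ) : Measurable (qqA k lam γ) := by
  unfold qqA
  exact Measurable.ennreal_tsum fun j => (tmA_meas k lam γ j).ennreal_ofReal

lemma tmA_nonneg {k lam γ : ℝ} (hk : 0 < k) (hl : 0 ≤ lam) (hγ : 0 < γ) (j : ℕ) {x : ℝ}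
    (hx : 0 < x) : 0 ≤ tmA k lam γ j x := by
  have : 0 < Real.Gamma (k + j) := Real.Gamma_pos_of_pos (by positivity)
  unfold tmA; positivity

lemma gamma_lb {k : ℝ} (hk : 0 < k) : ∃ c > 0, ∀ j : ℕ, c ≤ Real.Gamma (k + j) := by
  have h0 : 0 < Real.Gamma k := Real.Gamma_pos_of_pos hk
  have h1 : 0 < Real.Gamma (k + 1) := Real.Gamma_pos_of_pos (by positivity)
  have h2 : ∀ j : ℕ, Real.Gamma (k + 1) ≤ Real.Gamma (k + 1 + j) := by
    intro j
    induction j with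
    | zero => simp
    | succ n ih =>
      have : k + 1 + ((n + 1 : ℕ) : ℝ) = (k + 1 + n) + 1 := by push_cast; ring
      rw [this, Real.Gamma_add_one (s := k + 1 + n) (by positivity)]
      have hn : (0 : ℝ) ≤ n := Nat.cast_nonneg n
      nlinarith
  refine ⟨min (Real.Gamma k) (Real.Gamma (k + 1)), lt_min h0 h1, fun j => ?_⟩
  cases j with
  | zero => simp
  | succ n =>
    refine (min_le_right _ _).trans ((h2 n).trans (le_of_eq ?_))
    congr 1; push_cast; ring

lemma tmA_summable {k lam γ : ℝ} (hk : 0 < k) (hl : 0 ≤ lam) (hγ : 0 < γ) {x : ℝ}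
    (hx : 0 < x) : Summable fun j => tmA k lam γ j x := by
  obtain ⟨c, hc, hcj⟩ := gamma_lb hk
  have hy : 0 < x / γ := by positivity
  have hs := (Real.summable_pow_div_factorial (lam * (x / γ))).mul_left
    ((1 / γ) * Real.exp (-lam) * (x / γ) ^ (k - 1) * Real.exp (-(x / γ)) / c)
  refine Summable.of_nonneg_of_le (fun j => tmA_nonneg hk hl hγ j hx) (fun j => ?_) hs
  unfold tmA
  generalize x / γ = y at hy
  have e : y ^ (k + (j : ℝ) - 1) = y ^ (k - 1) * y ^ j := by
    rw [← Real.rpow_natCast y j, ← Real.rpow_add hy]; congr 1; ring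
  rw [e]
  have : (1 / γ) * ((Real.exp (-lam) * lam ^ j / (j.factorial : ℝ)) *
    (y ^ (k - 1) * y ^ j) * Real.exp (-y) / Real.Gamma (k + (j : ℝ)))
    = ((1 / γ) * Real.exp (-lam) * y ^ (k - 1) * Real.exp (-y)
      * ((lam * y) ^ j / (j.factorial : ℝ))) / Real.Gamma (k + j) := by
    rw [mul_pow]; ring
  rw [this]
  have h2 : (1 / γ) * Real.exp (-lam) * y ^ (k - 1) * Real.exp (-y) / c
      * ((lam * y) ^ j / (j.factorial : ℝ)) = ((1 / γ) * Real.exp (-lam) * y ^ (k - 1) * Real.exp (-y)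
      * ((lam * y) ^ j / (j.factorial : ℝ))) / c := by ring
  rw [h2]
  exact div_le_div_of_nonneg_left (by positivity) hc (hcj j)

lemma scaled_eq {k lam γ : ℝ} {x : ℝ} (hx : 0 < x) :
    ncx2Scaled k lam γ x = ∑' j, tmA k lam γ j x := by
  simp only [ncx2Scaled, hx, if_true, ncx2, tmA, tsum_mul_left]

lemma scaled_nonneg {k lam γ : ℝ} (hk : 0 < k) (hl : 0 ≤ lam) (hγ : 0 < γ) (x : ℝ) :
    0 ≤ ncx2Scaled k lam γ x := by
  by_cases hx : 0 < x
  · rw [scaled_eq hx]; exact tsum_nonneg fun j => tmA_nonneg hk hl hγ j hx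
  · simp [ncx2Scaled, hx]

lemma scaled_ofReal {k lam γ : ℝ} (hk : 0 < k) (hl : 0 ≤ lam) (hγ : 0 < γ) (x : ℝ) :
    ENNReal.ofReal (ncx2Scaled k lam γ x) = (Set.Ioi 0).indicator (qqA k lam γ) x := by
  by_cases hx : 0 < x
  · rw [Set.indicator_of_mem (by exact hx), scaled_eq hx,
      ENNReal.ofReal_tsum_of_nonneg (fun j => tmA_nonneg hk hl hγ j hx)
        (tmA_summable hk hl hγ hx)]
    rfl
  · rw [Set.indicator_of_notMem (by exact hx)]; simp [ncx2Scaled, hx]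

lemma law_eq {Ω : Type*} {mΩ : MeasurableSpace Ω} (μ : Measure Ω) [IsProbabilityMeasure μ]
    {k lam γ : ℝ} (hk : 0 < k) (hl : 0 ≤ lam) (hγ : 0 < γ) (W : Ω → ℝ) (hW : Measurable W)
    (hlaw : ∀ A : Set ℝ, MeasurableSet A →
      (μ (W ⁻¹' A)).toReal = ∫ x in A, ncx2Scaled k lam γ x) :
    μ.map W = (volume.restrict (Set.Ioi 0)).withDensity (qqA k lam γ) := by
  have hint : Integrable (ncx2Scaled k lam γ) := by
    apply integrable_of_integral_eq_one
    have := hlaw Set.univ MeasurableSet.univ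
    simpa using this.symm
  ext A hA
  rw [Measure.map_apply hW hA, withDensity_apply _ hA,
    ← ENNReal.ofReal_toReal (measure_ne_top μ (W ⁻¹' A)), hlaw A hA,
    ofReal_integral_eq_lintegral_ofReal hint.integrableOn
      (Filter.Eventually.of_forall fun x => scaled_nonneg hk hl hγ x)]
  simp_rw [scaled_ofReal hk hl hγ]
  rw [lintegral_indicator measurableSet_Ioi, Measure.restrict_restrict hA,
    Measure.restrict_restrict measurableSet_Ioi, Set.inter_comm]

lemma subst_Ioi {a : ℝ} (ha : 0 < a) {G : ℝ → ENNReal} (hG : Measurable G) :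
    ∫⁻ x in Set.Ioi 0, G x = ENNReal.ofReal a * ∫⁻ t in Set.Ioi 0, G (a * t) := by
  rw [← lintegral_indicator measurableSet_Ioi, ← lintegral_indicator measurableSet_Ioi]
  conv_lhs => rw [← Real.smul_map_volume_mul_left ha.ne']
  rw [lintegral_smul_measure, abs_of_pos ha, smul_eq_mul,
    lintegral_map (hG.indicator measurableSet_Ioi) (by fun_prop)]
  congr 1
  refine lintegral_congr fun t => ?_
  simp [Set.indicator, ha]

lemma mellin_conv {q₁ q₂ : ℝ → ENNReal} (h₁ : Measurable q₁) (h₂ : Measurable q₂)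
    {A : Set ℝ} (hA : MeasurableSet A) (hA0 : A ⊆ Set.Ioi 0) :
    ∫⁻ x in Set.Ioi 0, q₁ x * ∫⁻ y in Set.Ioi 0, q₂ y * A.indicator 1 (x * y)
      = ∫⁻ z in A, ∫⁻ x in Set.Ioi 0, q₁ x * (ENNReal.ofReal x⁻¹ * q₂ (z / x)) := by
  have hi : Measurable (A.indicator (1 : ℝ → ENNReal)) := measurable_one.indicator hA
  have e1 : ∀ x ∈ Set.Ioi (0 : ℝ),
      q₁ x * ∫⁻ y in Set.Ioi 0, q₂ y * A.indicator 1 (x * y)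
      = ∫⁻ z in A, q₁ x * (ENNReal.ofReal x⁻¹ * q₂ (z / x)) := by
    intro x hx
    have hx : 0 < x := hx
    rw [lintegral_const_mul _ (by fun_prop), lintegral_const_mul _ (by fun_prop)]
    congr 1
    rw [subst_Ioi (inv_pos.2 hx) (by fun_prop)]
    congr 1
    rw [← lintegral_indicator measurableSet_Ioi, ← lintegral_indicator hA]
    refine lintegral_congr fun z => ?_
    by_cases hz : z ∈ A
    · have : z ∈ Set.Ioi (0 : ℝ) := hA0 hz
      simp only [Set.indicator_of_mem this, Set.indicator_of_mem hz, mul_inv_cancel_left₀ hx.ne',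
        Pi.one_apply, mul_one]
      congr 1; ring
    · simp only [Set.indicator_of_notMem hz, mul_inv_cancel_left₀ hx.ne']
      simp [hz]
  rw [setLIntegral_congr_fun measurableSet_Ioi e1, lintegral_lintegral_swap]
  apply Measurable.aemeasurable
  simp only [Function.uncurry_def]
  fun_prop

lemma term_eq {k₁ k₂ lam₁ lam₂ γ₁ γ₂ : ℝ} (hγ₁ : 0 < γ₁) (hγ₂ : 0 < γ₂) (i j : ℕ) {z t : ℝ}
    (hz : 0 < z) (ht : 0 < t) :
    γ₁ * (tmA k₁ lam₁ γ₁ i (γ₁ * t) * ((γ₁ * t)⁻¹ * tmA k₂ lam₂ γ₂ j (z / (γ₁ * t))))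
    = (Real.exp (-lam₁) * lam₁ ^ i / (i.factorial : ℝ)) *
          (Real.exp (-lam₂) * lam₂ ^ j / (j.factorial : ℝ)) *
          (γ₁ * γ₂)⁻¹ * ((z / (γ₁ * γ₂)) ^ (k₂ + j - 1) /
            (Real.Gamma (k₁ + i) * Real.Gamma (k₂ + j)) *
          (t ^ (k₁ + i - (k₂ + j) - 1) * Real.exp (-t - (z / (γ₁ * γ₂)) / t))) := by
  unfold tmA
  have e1 : γ₁ * t / γ₁ = t := by field_simp
  have e2 : z / (γ₁ * t) / γ₂ = (z / (γ₁ * γ₂)) / t := by field_simp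
  rw [e1, e2]
  have hy : 0 < z / (γ₁ * γ₂) := by positivity
  generalize z / (γ₁ * γ₂) = y at hy
  have e3 : t ^ (k₁ + i - (k₂ + j) - 1) = t ^ (k₁ + i - 1) / t ^ (k₂ + j - 1) / t := by
    rw [← Real.rpow_sub ht, ← Real.rpow_sub_one ht.ne']; congr 1; ring
  have e4 : Real.exp (-t - y / t) = Real.exp (-t) * Real.exp (-(y / t)) := by
    rw [← Real.exp_add]; congr 1
  rw [e3, e4, Real.div_rpow hy.le ht.le]
  have : t ^ (k₂ + j - 1) ≠ 0 := (Real.rpow_pos_of_pos ht _).ne'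
  field_simp

lemma dens_eq {k₁ k₂ lam₁ lam₂ γ₁ γ₂ : ℝ} (hk₁ : 0 < k₁) (hk₂ : 0 < k₂)
    (hl₁ : 0 ≤ lam₁) (hl₂ : 0 ≤ lam₂) (hγ₁ : 0 < γ₁) (hγ₂ : 0 < γ₂) {z : ℝ} (hz : 0 < z)
    (hfin : ∫⁻ x in Set.Ioi 0, qqA k₁ lam₁ γ₁ x * (ENNReal.ofReal x⁻¹ * qqA k₂ lam₂ γ₂ (z / x)) < ⊤) :
    ∑' j₁ : ℕ, ∑' j₂ : ℕ,
          (Real.exp (-lam₁) * lam₁ ^ j₁ / (j₁.factorial : ℝ)) *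
          (Real.exp (-lam₂) * lam₂ ^ j₂ / (j₂.factorial : ℝ)) *
          (γ₁ * γ₂)⁻¹ *
          gammaProdDensity (k₁ + j₁) (k₂ + j₂) (z / (γ₁ * γ₂))
    = (∫⁻ x in Set.Ioi 0,
        qqA k₁ lam₁ γ₁ x * (ENNReal.ofReal x⁻¹ * qqA k₂ lam₂ γ₂ (z / x))).toReal := by
  set F : ℕ → ℕ → ℝ → ℝ := fun i j t => (Real.exp (-lam₁) * lam₁ ^ i / (i.factorial : ℝ)) *
          (Real.exp (-lam₂) * lam₂ ^ j / (j.factorial : ℝ)) *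
          (γ₁ * γ₂)⁻¹ * ((z / (γ₁ * γ₂)) ^ (k₂ + j - 1) /
            (Real.Gamma (k₁ + i) * Real.Gamma (k₂ + j)) *
          (t ^ (k₁ + i - (k₂ + j) - 1) * Real.exp (-t - (z / (γ₁ * γ₂)) / t))) with hF
  have hFm : ∀ i j, Measurable (F i j) := fun i j => by simp only [hF]; fun_prop
  have hFn : ∀ i j, ∀ t ∈ Set.Ioi (0 : ℝ), 0 ≤ F i j t := by
    intro i j t ht
    have ht : 0 < t := ht
    have g1 : 0 < Real.Gamma (k₁ + i) := Real.Gamma_pos_of_pos (by positivity)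
    have g2 : 0 < Real.Gamma (k₂ + j) := Real.Gamma_pos_of_pos (by positivity)
    simp only [hF]; positivity
  have m1 := qqA_meas k₁ lam₁ γ₁
  have m2 := qqA_meas k₂ lam₂ γ₂
  have key : ∫⁻ x in Set.Ioi 0,
        qqA k₁ lam₁ γ₁ x * (ENNReal.ofReal x⁻¹ * qqA k₂ lam₂ γ₂ (z / x))
      = ∑' i, ∑' j, ∫⁻ t in Set.Ioi 0, ENNReal.ofReal (F i j t) := by
    rw [subst_Ioi hγ₁ (by fun_prop), ← lintegral_const_mul _ (by fun_prop)]
    have : ∀ t ∈ Set.Ioi (0 : ℝ), ENNReal.ofReal γ₁ * (qqA k₁ lam₁ γ₁ (γ₁ * t) *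
        (ENNReal.ofReal (γ₁ * t)⁻¹ * qqA k₂ lam₂ γ₂ (z / (γ₁ * t))))
        = ∑' i, ∑' j, ENNReal.ofReal (F i j t) := by
      intro t ht
      have ht : 0 < t := ht
      have hgt : 0 < γ₁ * t := by positivity
      have hzt : 0 < z / (γ₁ * t) := by positivity
      unfold qqA
      rw [← ENNReal.tsum_mul_right, ← ENNReal.tsum_mul_left]
      congr 1; ext1 i
      rw [← ENNReal.tsum_mul_left, ← ENNReal.tsum_mul_left, ← ENNReal.tsum_mul_left]
      congr 1; ext1 j
      rw [← ENNReal.ofReal_mul (by positivity),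
        ← ENNReal.ofReal_mul (tmA_nonneg hk₁ hl₁ hγ₁ i hgt), ← ENNReal.ofReal_mul hγ₁.le,
        term_eq hγ₁ hγ₂ i j hz ht]
    rw [setLIntegral_congr_fun measurableSet_Ioi this, lintegral_tsum]
    · congr 1; ext1 i
      rw [lintegral_tsum]
      exact fun j => (hFm i j).ennreal_ofReal.aemeasurable
    · exact fun i => (Measurable.ennreal_tsum fun j => (hFm i j).ennreal_ofReal).aemeasurable
  rw [key] at hfin ⊢
  have f1 : ∀ i, ∑' j, ∫⁻ t in Set.Ioi 0, ENNReal.ofReal (F i j t) ≠ ⊤ :=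
    ENNReal.ne_top_of_tsum_ne_top hfin.ne
  have f2 : ∀ i j, ∫⁻ t in Set.Ioi 0, ENNReal.ofReal (F i j t) ≠ ⊤ :=
    fun i => ENNReal.ne_top_of_tsum_ne_top (f1 i)
  rw [ENNReal.tsum_toReal_eq f1]
  congr 1; ext1 i
  rw [ENNReal.tsum_toReal_eq (f2 i)]
  congr 1; ext1 j
  rw [← integral_eq_lintegral_of_nonneg_ae
    ((ae_restrict_iff' measurableSet_Ioi).2 (Filter.Eventually.of_forall (hFn i j)))
    (hFm i j).aestronglyMeasurable]
  simp only [hF, integral_const_mul, gammaProdDensity]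

/-- The product of two independent noncentral chi-square random variables is a double
Poisson mixture of generalized-K-squared laws. -/
theorem stmt18 {Ω : Type*} {mΩ : MeasurableSpace Ω} (μ : Measure Ω) [IsProbabilityMeasure μ]
    (k₁ k₂ : ℝ) (hk₁ : 0 < k₁) (hk₂ : 0 < k₂)
    (lam₁ lam₂ : ℝ) (hlam₁ : 0 ≤ lam₁) (hlam₂ : 0 ≤ lam₂)
    (γ₁ γ₂ : ℝ) (hγ₁ : 0 < γ₁) (hγ₂ : 0 < γ₂)
    (W₁ W₂ : Ω → ℝ) (hW₁ : Measurable W₁) (hW₂ : Measurable W₂)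
    (hW₁law : ∀ A : Set ℝ, MeasurableSet A →
      (μ (W₁ ⁻¹' A)).toReal = ∫ x in A, ncx2Scaled k₁ lam₁ γ₁ x)
    (hW₂law : ∀ A : Set ℝ, MeasurableSet A →
      (μ (W₂ ⁻¹' A)).toReal = ∫ x in A, ncx2Scaled k₂ lam₂ γ₂ x)
    (hindep : IndepFun W₁ W₂ μ)
    (A : Set ℝ) (hA : MeasurableSet A) (hA0 : A ⊆ Set.Ioi 0) :
    (μ {ω | W₁ ω * W₂ ω ∈ A}).toReal
      = ∫ x in A, ∑' j₁ : ℕ, ∑' j₂ : ℕ,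
          (Real.exp (-lam₁) * lam₁ ^ j₁ / (j₁.factorial : ℝ)) *
          (Real.exp (-lam₂) * lam₂ ^ j₂ / (j₂.factorial : ℝ)) *
          (γ₁ * γ₂)⁻¹ *
          gammaProdDensity (k₁ + j₁) (k₂ + j₂) (x / (γ₁ * γ₂)) := by
  have m1 := qqA_meas k₁ lam₁ γ₁
  have m2 := qqA_meas k₂ lam₂ γ₂
  have hi : Measurable (A.indicator (1 : ℝ → ENNReal)) := measurable_one.indicator hA
  have hset : MeasurableSet {p : ℝ × ℝ | p.1 * p.2 ∈ A} :=
    (measurable_fst.mul measurable_snd) hA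
  have hμ : μ {ω | W₁ ω * W₂ ω ∈ A} = ∫⁻ z in A, ∫⁻ x in Set.Ioi 0,
      qqA k₁ lam₁ γ₁ x * (ENNReal.ofReal x⁻¹ * qqA k₂ lam₂ γ₂ (z / x)) := by
    have h1 : μ {ω | W₁ ω * W₂ ω ∈ A}
        = (μ.map (fun ω => (W₁ ω, W₂ ω))) {p : ℝ × ℝ | p.1 * p.2 ∈ A} := by
      rw [Measure.map_apply (hW₁.prodMk hW₂) hset]; rfl
    have := Measure.isProbabilityMeasure_map (μ := μ) hW₂.aemeasurable
    rw [h1, (indepFun_iff_map_prod_eq_prod_map_map hW₁.aemeasurable hW₂.aemeasurable).1 hindep,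
      Measure.prod_apply hset, law_eq μ hk₁ hlam₁ hγ₁ W₁ hW₁ hW₁law,
      lintegral_withDensity_eq_lintegral_mul _ m1 (measurable_measure_prodMk_left hset),
      ← mellin_conv m1 m2 hA hA0]
    refine lintegral_congr fun x => ?_
    simp only [Pi.mul_apply]
    congr 1
    have hx : MeasurableSet (Prod.mk x ⁻¹' {p : ℝ × ℝ | p.1 * p.2 ∈ A}) :=
      measurable_prodMk_left hset
    rw [law_eq μ hk₂ hlam₂ hγ₂ W₂ hW₂ hW₂law, withDensity_apply _ hx, ← lintegral_indicator hx]
    refine lintegral_congr fun y => ?_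
    by_cases hxy : x * y ∈ A
    · simp [Set.indicator, hxy]
    · simp [Set.indicator, hxy]
  have hS : Measurable fun z : ℝ => ∫⁻ x in Set.Ioi 0,
      qqA k₁ lam₁ γ₁ x * (ENNReal.ofReal x⁻¹ * qqA k₂ lam₂ γ₂ (z / x)) := by
    apply Measurable.lintegral_prod_right'
      (f := fun p : ℝ × ℝ => qqA k₁ lam₁ γ₁ p.2 * (ENNReal.ofReal p.2⁻¹ * qqA k₂ lam₂ γ₂ (p.1 / p.2)))
    fun_prop
  have hfin := ae_lt_top (μ := volume.restrict A) hS (by rw [← hμ]; exact measure_ne_top _ _)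
  rw [hμ, ← integral_toReal hS.aemeasurable hfin]
  refine integral_congr_ae ?_
  filter_upwards [hfin, ae_restrict_mem hA] with z hz hzA
  exact (dens_eq hk₁ hk₂ hlam₁ hlam₂ hγ₁ hγ₂ (hA0 hzA) hz).symm
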